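/- Let d ∈ {1,2,3}, let Ω ⊆ ℝ^d be a nonempty bounded open set, let b, c > 0 and T > 0. There exists C_T > 0 (depending on d, Ω, b, c, T) such that: if ψ and f are admissible, v := ψ_t, and v_t − b Δv − c² Δψ = f on [0,T] × Ω, then sup_{t∈[0,T]} √t‖Δv(t)‖ ≤ C_T(‖ψ(0)‖_{H²} + ‖v(0)‖_{H¹} + (∫₀ᵀ‖f(t)‖² dt)^{1/2} + sup_{t∈[0,T]}√t‖f(t)‖ + (∫₀ᵀ t‖f_t(t)‖_{H⁻¹(Ω)}² dt)^{1/2}). -/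

import Mathlib

open MeasureTheory Real

noncomputable section

/-- Euclidean space ℝ^d. -/
abbrev Spc (d : ℕ) := EuclideanSpace ℝ (Fin d)

variable {d : ℕ}

/-- Spatial Laplacian: sum of second derivatives in the coordinate directions. -/
def lap (g : Spc d → ℝ) (x : Spc d) : ℝ :=
  ∑ i, fderiv ℝ (fun y => fderiv ℝ g y (EuclideanSpace.single i 1)) x (EuclideanSpace.single i 1)

/-- Squared L²(Ω) norm: ‖g‖² = ∫_Ω g². -/
def sqL2 (Ω : Set (Spc d)) (g : Spc d → ℝ) : ℝ := ∫ x in Ω, (g x) ^ 2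

/-- Squared L²(Ω) norm of the gradient: ‖∇g‖² = ∫_Ω |∇g|². -/
def sqGrad (Ω : Set (Spc d)) (g : Spc d → ℝ) : ℝ := ∫ x in Ω, ‖gradient g x‖ ^ 2

/-- Squared L²(Ω) norm of the Hessian: ‖D²g‖² = ∫_Ω |D²g|². -/
def sqHess (Ω : Set (Spc d)) (g : Spc d → ℝ) : ℝ := ∫ x in Ω, ‖iteratedFDeriv ℝ 2 g x‖ ^ 2

/-- Squared H¹(Ω) norm. -/
def sqH1 (Ω : Set (Spc d)) (g : Spc d → ℝ) : ℝ := sqL2 Ω g + sqGrad Ω g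

/-- Squared H²(Ω) norm. -/
def sqH2 (Ω : Set (Spc d)) (g : Spc d → ℝ) : ℝ := sqL2 Ω g + sqGrad Ω g + sqHess Ω g

/-- H⁻¹(Ω) norm by duality against smooth compactly supported test functions. -/
def negH1 (Ω : Set (Spc d)) (g : Spc d → ℝ) : ℝ :=
  sSup { r : ℝ | ∃ φ : Spc d → ℝ, ContDiff ℝ (⊤ : ℕ∞) φ ∧ HasCompactSupport φ ∧ tsupport φ ⊆ Ω ∧
      (∫ x in Ω, ‖gradient φ x‖ ^ 2) ≤ 1 ∧ r = ∫ x in Ω, g x * φ x }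

/-- Admissible: smooth in (t,x), with spatial support in a fixed compact subset of Ω. -/
def Admissible (Ω : Set (Spc d)) (w : ℝ → Spc d → ℝ) : Prop :=
  ContDiff ℝ (⊤ : ℕ∞) (fun p : ℝ × Spc d => w p.1 p.2) ∧
  ∃ K : Set (Spc d), IsCompact K ∧ K ⊆ Ω ∧ ∀ t, Function.support (w t) ⊆ K

/-- Inner product of two spatial gradients: ∇g·∇h. -/
def gdot (g h : Spc d → ℝ) (x : Spc d) : ℝ := @inner ℝ _ _ (gradient g x) (gradient h x)

/-- Time derivative. -/
def tderiv (w : ℝ → Spc d → ℝ) (t : ℝ) (x : Spc d) : ℝ := deriv (fun s => w s x) t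

/-- The Blackstock equation ψ_tt − c²(1 − 2k ψ_t)Δψ − b Δψ_t + 2σ ∇ψ·∇ψ_t = 0
holds at time `t` on `Ω`. -/
def IsBlackstock (Ω : Set (Spc d)) (b c k σ : ℝ) (ψ : ℝ → Spc d → ℝ) (t : ℝ) : Prop :=
  ∀ x ∈ Ω,
    (tderiv (tderiv ψ) t x - c ^ 2 * (1 - 2 * k * tderiv ψ t x) * lap (ψ t) x
      - b * lap (tderiv ψ t) x
      + 2 * σ * gdot (ψ t) (tderiv ψ t) x) = 0

/-- Energy E(t). -/
def energy (Ω : Set (Spc d)) (b c : ℝ) (ψ : ℝ → Spc d → ℝ) (t : ℝ) : ℝ :=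
  (1 / 2) * sqL2 Ω (tderiv ψ t) + (c ^ 2 / 2) * sqGrad Ω (ψ t)
    + (c ^ 2 / (2 * b)) * sqL2 Ω (lap (ψ t)) + sqGrad Ω (tderiv ψ t)

/-- Dissipation D(t). -/
def dissip (Ω : Set (Spc d)) (ψ : ℝ → Spc d → ℝ) (t : ℝ) : ℝ :=
  ∫ s in (0:ℝ)..t,
    (sqGrad Ω (tderiv ψ s) + sqL2 Ω (lap (tderiv ψ s)) + sqGrad Ω (ψ s)
      + sqL2 Ω (lap (ψ s)) + sqL2 Ω (tderiv (tderiv ψ) s))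

/-- Supremum of a function of time over [0,T]. -/
def supIcc (T : ℝ) (f : ℝ → ℝ) : ℝ := ⨆ t : Set.Icc (0:ℝ) T, f t

/-- f := −2k c² ψ_t Δψ − 2σ ∇ψ·∇ψ_t, the right-hand side nonlinearity. -/
def blackF (c k σ : ℝ) (ψ : ℝ → Spc d → ℝ) (t : ℝ) (x : Spc d) : ℝ :=
  -(2 * k * c ^ 2) * tderiv ψ t x * lap (ψ t) x - 2 * σ * gdot (ψ t) (tderiv ψ t) x

/-- The nonlocal heat equation v_t − b Δv − c² Δψ = f (with v = ψ_t) holds at time `t` on `Ω`. -/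
def IsHeat (Ω : Set (Spc d)) (b c : ℝ) (ψ f : ℝ → Spc d → ℝ) (t : ℝ) : Prop :=
  ∀ x ∈ Ω,
    tderiv (tderiv ψ) t x - b * lap (tderiv ψ t) x - c ^ 2 * lap (ψ t) x = f t x

/-- The linearized Blackstock equation
ψ_tt − c²(1 − 2k α)Δψ − b Δψ_t + 2σ ∇ψ·∇α = f̃ holds at time `t` on `Ω`. -/
def IsLinBlackstock (Ω : Set (Spc d)) (b c k σ : ℝ) (α ψ f : ℝ → Spc d → ℝ) (t : ℝ) : Prop :=
  ∀ x ∈ Ω,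
    tderiv (tderiv ψ) t x - c ^ 2 * (1 - 2 * k * α t x) * lap (ψ t) x
      - b * lap (tderiv ψ t) x + 2 * σ * gdot (ψ t) (α t) x = f t x

/-- Time-weighted norm N_T^v for the velocity variable. -/
def normV (Ω : Set (Spc d)) (T : ℝ) (α : ℝ → Spc d → ℝ) : ℝ :=
  supIcc T (fun t => Real.sqrt (sqH1 Ω (α t)))
    + Real.sqrt (∫ t in (0:ℝ)..T, (sqL2 Ω (α t) + sqGrad Ω (α t) + sqL2 Ω (lap (α t))))
    + Real.sqrt (∫ t in (0:ℝ)..T, sqL2 Ω (tderiv α t))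
    + supIcc T (fun t => Real.sqrt t * Real.sqrt (sqL2 Ω (tderiv α t)))
    + Real.sqrt (∫ t in (0:ℝ)..T, t * sqGrad Ω (tderiv α t))
    + supIcc T (fun t => Real.sqrt t * Real.sqrt (sqL2 Ω (lap (α t))))

/-- Time-weighted solution norm N_T(ψ) = sup_{[0,T]} ‖ψ(t)‖_{H²} + N_T^v(ψ_t). -/
def normX (Ω : Set (Spc d)) (T : ℝ) (ψ : ℝ → Spc d → ℝ) : ℝ :=
  supIcc T (fun t => Real.sqrt (sqH2 Ω (ψ t))) + normV Ω T (tderiv ψ)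


/-- Spatial partial derivative. -/
def pd (i : Fin d) (w : ℝ → Spc d → ℝ) (t : ℝ) (x : Spc d) : ℝ :=
  fderiv ℝ (w t) x (EuclideanSpace.single i 1)

def unc (w : ℝ → Spc d → ℝ) (p : ℝ × Spc d) : ℝ := w p.1 p.2

theorem td_eq {w : ℝ → Spc d → ℝ} (h : ContDiff ℝ (⊤ : ℕ∞) (unc w)) (t : ℝ) (x : Spc d) :
    HasDerivAt (fun s => w s x) (fderiv ℝ (unc w) (t, x) ((1 : ℝ), (0 : Spc d))) t := by
  have h1 : HasFDerivAt (unc w) (fderiv ℝ (unc w) (t, x)) (t, x) :=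
    ((h.differentiable (by simp)) (t, x)).hasFDerivAt
  have h2 : HasDerivAt (fun s : ℝ => (s, x)) ((1 : ℝ), (0 : Spc d)) t :=
    (hasDerivAt_id t).prodMk (hasDerivAt_const t x)
  exact h1.comp_hasDerivAt t h2

theorem pd_eq {w : ℝ → Spc d → ℝ} (h : ContDiff ℝ (⊤ : ℕ∞) (unc w)) (i : Fin d)
    (t : ℝ) (x : Spc d) :
    pd i w t x = fderiv ℝ (unc w) (t, x) ((0 : ℝ), (EuclideanSpace.single i 1 : Spc d)) := by
  have h1 : HasFDerivAt (unc w) (fderiv ℝ (unc w) (t, x)) (t, x) :=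
    ((h.differentiable (by simp)) (t, x)).hasFDerivAt
  have h2 : HasFDerivAt (fun y : Spc d => (t, y)) (ContinuousLinearMap.inr ℝ ℝ (Spc d)) x := by
    exact hasFDerivAt_prodMk_right t x
  have h3 : HasFDerivAt (w t) ((fderiv ℝ (unc w) (t, x)).comp
      (ContinuousLinearMap.inr ℝ ℝ (Spc d))) x := h1.comp x h2
  simp [pd, h3.fderiv]

theorem unc_td {w : ℝ → Spc d → ℝ} (h : ContDiff ℝ (⊤ : ℕ∞) (unc w)) :
    unc (tderiv w) = fun p => fderiv ℝ (unc w) p ((1 : ℝ), (0 : Spc d)) := by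
  funext ⟨t, x⟩
  exact (td_eq h t x).deriv

theorem unc_pd {w : ℝ → Spc d → ℝ} (h : ContDiff ℝ (⊤ : ℕ∞) (unc w)) (i : Fin d) :
    unc (pd i w) = fun p => fderiv ℝ (unc w) p ((0 : ℝ), (EuclideanSpace.single i 1 : Spc d)) := by
  funext ⟨t, x⟩
  exact pd_eq h i t x

theorem smooth_dir {E : Type*} [NormedAddCommGroup E] [NormedSpace ℝ E] {W : E → ℝ}
    (h : ContDiff ℝ (⊤ : ℕ∞) W) (v : E) : ContDiff ℝ (⊤ : ℕ∞) (fun p => fderiv ℝ W p v) := by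
  have : ContDiff ℝ (⊤ : ℕ∞) (fderiv ℝ W) := h.fderiv_right (by simp)
  exact this.clm_apply contDiff_const

theorem dir_comm {E : Type*} [NormedAddCommGroup E] [NormedSpace ℝ E] {W : E → ℝ}
    (h : ContDiff ℝ (⊤ : ℕ∞) W) (u v : E) (p : E) :
    fderiv ℝ (fun q => fderiv ℝ W q u) p v = fderiv ℝ (fun q => fderiv ℝ W q v) p u := by
  have h1 : ContDiff ℝ (⊤ : ℕ∞) (fderiv ℝ W) := h.fderiv_right (by simp)
  have h2 : DifferentiableAt ℝ (fderiv ℝ W) p := (h1.differentiable (by simp)) p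
  have hs : IsSymmSndFDerivAt ℝ W p := h.contDiffAt.isSymmSndFDerivAt (by
    simp only [minSmoothness_of_isRCLikeNormedField]
    exact WithTop.coe_le_coe.2 (le_top : (2 : ℕ∞) ≤ ⊤))
  have key : ∀ a b : E, fderiv ℝ (fun q => fderiv ℝ W q a) p b = fderiv ℝ (fderiv ℝ W) p b a := by
    intro a b
    rw [fderiv_clm_apply h2 (differentiableAt_const a)]
    simp
  rw [key, key]
  exact hs v u

namespace Admissible

variable {Ω : Set (Spc d)} {u w : ℝ → Spc d → ℝ}

theorem smooth (h : Admissible Ω w) : ContDiff ℝ (⊤ : ℕ∞) (unc w) := h.1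

theorem td (h : Admissible Ω w) : Admissible Ω (tderiv w) := by
  refine ⟨?_, ?_⟩
  · change ContDiff ℝ (⊤ : ℕ∞) (unc (tderiv w))
    rw [unc_td h.smooth]
    exact smooth_dir h.smooth _
  · obtain ⟨K, hK, hKΩ, hs⟩ := h.2
    refine ⟨K, hK, hKΩ, fun t x hx => ?_⟩
    by_contra hxK
    apply hx
    have : (fun s => w s x) = fun _ => 0 := by
      funext s
      by_contra h0
      exact hxK (hs s h0)
    simp [tderiv, this]

theorem pd (h : Admissible Ω w) (i : Fin d) : Admissible Ω (pd i w) := by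
  refine ⟨?_, ?_⟩
  · change ContDiff ℝ (⊤ : ℕ∞) (unc (_root_.pd i w))
    rw [unc_pd h.smooth]
    exact smooth_dir h.smooth _
  · obtain ⟨K, hK, hKΩ, hs⟩ := h.2
    refine ⟨K, hK, hKΩ, fun t x hx => ?_⟩
    by_contra hxK
    apply hx
    have : (w t) =ᶠ[nhds x] fun _ => 0 := by
      filter_upwards [hK.isClosed.isOpen_compl.mem_nhds hxK] with y hy
      by_contra h0
      exact hy (hs t h0)
    simp [_root_.pd, this.fderiv_eq]

theorem zero : Admissible Ω (fun _ _ => (0:ℝ)) :=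
  ⟨contDiff_const, ∅, isCompact_empty, by simp, by simp⟩

theorem mul (hu : Admissible Ω u) (h : Admissible Ω w) :
    Admissible Ω (fun t x => u t x * w t x) := by
  refine ⟨hu.1.mul h.1, ?_⟩
  obtain ⟨K, hK, hKΩ, hs⟩ := h.2
  exact ⟨K, hK, hKΩ, fun t x hx => hs t (right_ne_zero_of_mul hx)⟩

theorem add (hu : Admissible Ω u) (h : Admissible Ω w) :
    Admissible Ω (fun t x => u t x + w t x) := by
  refine ⟨hu.1.add h.1, ?_⟩
  obtain ⟨K, hK, hKΩ, hs⟩ := h.2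
  obtain ⟨K', hK', hKΩ', hs'⟩ := hu.2
  refine ⟨K ∪ K', hK.union hK', Set.union_subset hKΩ hKΩ', fun t x hx => ?_⟩
  by_contra hn
  simp only [Set.mem_union, not_or] at hn
  apply hx
  have h1 : w t x = 0 := by
    by_contra h0
    exact hn.1 (hs t h0)
  have h2 : u t x = 0 := by
    by_contra h0
    exact hn.2 (hs' t h0)
  simp [h1, h2]

theorem smul (h : Admissible Ω w) (r : ℝ) : Admissible Ω (fun t x => r * w t x) := by
  refine ⟨contDiff_const.mul h.1, ?_⟩
  obtain ⟨K, hK, hKΩ, hs⟩ := h.2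
  exact ⟨K, hK, hKΩ, fun t x hx => hs t (right_ne_zero_of_mul hx)⟩

theorem sq (h : Admissible Ω w) : Admissible Ω (fun t x => w t x ^ 2) := by
  simpa [pow_two] using h.mul h

theorem fsum {ι : Type*} (s : Finset ι) {W : ι → ℝ → Spc d → ℝ} (h : ∀ i, Admissible Ω (W i)) :
    Admissible Ω (fun t x => ∑ i ∈ s, W i t x) := by
  classical
  induction s using Finset.induction_on with
  | empty => simpa using zero
  | insert a s ha ih => simpa [Finset.sum_insert ha] using (h a).add ih

theorem lap (h : Admissible Ω w) : Admissible Ω (fun t => lap (w t)) :=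
  fsum (W := fun i => _root_.pd i (_root_.pd i w)) Finset.univ fun i => (h.pd i).pd i

theorem slice (h : Admissible Ω w) (t : ℝ) : ContDiff ℝ (⊤ : ℕ∞) (w t) :=
  h.1.comp (contDiff_const.prodMk contDiff_id : ContDiff ℝ (⊤ : ℕ∞) fun x : Spc d => (t, x))

theorem tsupp (h : Admissible Ω w) (t : ℝ) :
    HasCompactSupport (w t) ∧ tsupport (w t) ⊆ Ω := by
  obtain ⟨K, hK, hKΩ, hs⟩ := h.2
  have h1 : tsupport (w t) ⊆ K := closure_minimal (hs t) hK.isClosed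
  exact ⟨hK.of_isClosed_subset (isClosed_tsupport _) h1, h1.trans hKΩ⟩

theorem of_test {φ : Spc d → ℝ} (h : ContDiff ℝ (⊤ : ℕ∞) φ) (hc : HasCompactSupport φ)
    (hs : tsupport φ ⊆ Ω) : Admissible Ω (fun _ => φ) :=
  ⟨h.comp contDiff_snd, tsupport φ, hc, hs, fun _ => subset_tsupport φ⟩

theorem integrable (h : Admissible Ω w) (t : ℝ) : Integrable (w t) :=
  (h.slice t).continuous.integrable_of_hasCompactSupport (h.tsupp t).1

theorem integrableOn (h : Admissible Ω w) (t : ℝ) : Integrable (w t) (volume.restrict Ω) :=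
  (h.integrable t).restrict

theorem eq_zero (h : Admissible Ω w) {t : ℝ} {x : Spc d} (hx : x ∉ Ω) : w t x = 0 := by
  by_contra h0
  exact hx ((h.tsupp t).2 (subset_tsupport _ h0))

theorem setInt (h : Admissible Ω w) (t : ℝ) : ∫ x in Ω, w t x = ∫ x, w t x :=
  setIntegral_eq_integral_of_forall_compl_eq_zero fun _ hx => h.eq_zero hx

theorem hasDerivAt (h : Admissible Ω w) (t : ℝ) (x : Spc d) :
    HasDerivAt (fun s => w s x) (tderiv w t x) t := by
  have := td_eq h.smooth t x
  have h2 : tderiv w t x = _ := this.deriv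
  rwa [h2]

/-- Differentiation under the integral sign. -/
theorem hasDerivAt_int (h : Admissible Ω w) (t : ℝ) :
    HasDerivAt (fun s => ∫ x in Ω, w s x) (∫ x in Ω, tderiv w t x) t := by
  have hcont : Continuous (unc (tderiv w)) := h.td.smooth.continuous
  obtain ⟨K, hK, hKΩ, hs⟩ := h.td.2
  have hcpt : IsCompact ((Set.Icc (t-1) (t+1)) ×ˢ K) := isCompact_Icc.prod hK
  obtain ⟨C, hC⟩ := hcpt.exists_bound_of_continuousOn hcont.continuousOn
  have hfin : volume K < ⊤ := hK.measure_lt_top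
  have hb : Integrable (K.indicator fun _ : Spc d => C) (volume.restrict Ω) := by
    apply Integrable.restrict
    rw [integrable_indicator_iff hK.isClosed.measurableSet]
    exact integrableOn_const hfin.ne
  refine (hasDerivAt_integral_of_dominated_loc_of_deriv_le (F := w) (F' := tderiv w)
    (s := Set.Icc (t-1) (t+1)) (bound := K.indicator fun _ => C)
    (Icc_mem_nhds (by linarith) (by linarith)) ?_ (h.integrableOn t)
    (h.td.integrableOn t).aestronglyMeasurable ?_ hb ?_).2
  · exact Filter.Eventually.of_forall fun s => (h.integrableOn s).aestronglyMeasurable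
  · refine Filter.Eventually.of_forall fun x s hsI => ?_
    by_cases hx : x ∈ K
    · simp only [Set.indicator_of_mem hx]
      exact hC (s, x) ⟨hsI, hx⟩
    · have : tderiv w s x = 0 := by
        by_contra h0
        exact hx (hs s h0)
      simp [this, Set.indicator_of_notMem hx]
  · exact Filter.Eventually.of_forall fun x s _ => h.hasDerivAt s x

theorem cont_int (h : Admissible Ω w) : Continuous (fun s => ∫ x in Ω, w s x) :=
  continuous_iff_continuousAt.2 fun t => (h.hasDerivAt_int t).continuousAt

theorem hasDerivAt_sq (h : Admissible Ω w) (t : ℝ) :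
    HasDerivAt (fun s => sqL2 Ω (w s)) (2 * ∫ x in Ω, w t x * tderiv w t x) t := by
  have := h.sq.hasDerivAt_int t
  have h2 : ∀ x, tderiv (fun t x => w t x ^ 2) t x = 2 * (w t x * tderiv w t x) := by
    intro x
    have := ((h.hasDerivAt t x).pow 2).deriv
    simp only [tderiv]
    refine Eq.trans this ?_
    simp [tderiv]; ring
  simp only [h2, integral_const_mul] at this
  exact this

theorem td_pd (h : Admissible Ω w) (i : Fin d) :
    tderiv (_root_.pd i w) = _root_.pd i (tderiv w) := by
  funext t x
  have h1 : unc (tderiv (_root_.pd i w)) (t, x) = unc (_root_.pd i (tderiv w)) (t, x) := by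
    rw [unc_td (h.pd i).smooth, unc_pd h.td.smooth, unc_td h.smooth, unc_pd h.smooth]
    exact dir_comm h.smooth _ _ _
  exact h1

theorem td_lap (h : Admissible Ω w) (t : ℝ) (x : Spc d) :
    tderiv (fun t => _root_.lap (w t)) t x = _root_.lap (tderiv w t) x := by
  have : HasDerivAt (fun s => ∑ i, _root_.pd i (_root_.pd i w) s x)
      (∑ i, _root_.pd i (_root_.pd i (tderiv w)) t x) t := by
    apply HasDerivAt.fun_sum
    intro i _
    rw [← h.td_pd, ← (h.pd i).td_pd]
    exact ((h.pd i).pd i).hasDerivAt t x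
  exact this.deriv

theorem ibp (hu : Admissible Ω u) (h : Admissible Ω w) (i : Fin d) (t : ℝ) :
    ∫ x in Ω, u t x * _root_.pd i w t x = - ∫ x in Ω, _root_.pd i u t x * w t x := by
  rw [(hu.mul (h.pd i)).setInt t, ((hu.pd i).mul h).setInt t]
  exact integral_mul_fderiv_eq_neg_fderiv_mul_of_integrable
    (((hu.pd i).mul h).integrable t) ((hu.mul (h.pd i)).integrable t)
    ((hu.mul h).integrable t)
    (fun x _ => (hu.slice t).differentiable (by simp) x)
    (fun x _ => (h.slice t).differentiable (by simp) x)

theorem ibp_lap (hu : Admissible Ω u) (h : Admissible Ω w) (t : ℝ) :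
    ∫ x in Ω, u t x * _root_.lap (w t) x
      = - ∑ i, ∫ x in Ω, _root_.pd i u t x * _root_.pd i w t x := by
  have h1 : ∀ x, u t x * _root_.lap (w t) x
      = ∑ i, u t x * _root_.pd i (_root_.pd i w) t x := by
    intro x
    rw [← Finset.mul_sum]; rfl
  simp only [h1]
  rw [integral_finsetSum _ fun i _ => (hu.mul ((h.pd i).pd i)).integrableOn t]
  rw [← Finset.sum_neg_distrib]
  exact Finset.sum_congr rfl fun i _ => hu.ibp (h.pd i) i t

theorem grad_sq (w : ℝ → Spc d → ℝ) (t : ℝ) (x : Spc d) :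
    ‖gradient (w t) x‖ ^ 2 = ∑ i, (_root_.pd i w t x) ^ 2 := by
  rw [EuclideanSpace.real_norm_sq_eq]
  refine Finset.sum_congr rfl fun i _ => ?_
  congr 1
  have h1 : (gradient (w t) x) i = inner ℝ (gradient (w t) x) (EuclideanSpace.single i (1:ℝ)) := by
    rw [EuclideanSpace.inner_single_right]
    simp
  rw [h1, gradient, InnerProductSpace.toDual_symm_apply]
  rfl

theorem sqGrad_eq (h : Admissible Ω w) (t : ℝ) :
    sqGrad Ω (w t) = ∑ i, sqL2 Ω (_root_.pd i w t) := by
  simp only [sqGrad, sqL2, grad_sq]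
  rw [integral_finsetSum _ fun i _ => (h.pd i).sq.integrableOn t]

theorem sqGrad_eq_lap (h : Admissible Ω w) (t : ℝ) :
    ∫ x in Ω, w t x * _root_.lap (w t) x = - sqGrad Ω (w t) := by
  rw [h.ibp_lap h, h.sqGrad_eq]
  simp [sqL2, pow_two]

theorem hasDerivAt_grad (h : Admissible Ω w) (t : ℝ) :
    HasDerivAt (fun s => sqGrad Ω (w s)) (-2 * ∫ x in Ω, tderiv w t x * _root_.lap (w t) x) t := by
  simp only [h.sqGrad_eq]
  rw [h.td.ibp_lap h]
  have := HasDerivAt.fun_sum (u := Finset.univ) fun i _ => (h.pd i).hasDerivAt_sq t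
  refine this.congr_deriv ?_
  rw [← Finset.mul_sum]
  simp only [h.td_pd, mul_comm (_root_.pd _ w t _)]
  ring

/-- Poincare inequality. -/
theorem poincare (hop : IsOpen Ω) (h : Admissible Ω w) (t : ℝ) {R : ℝ} (hR : ∀ x ∈ Ω, ‖x‖ ≤ R) (i : Fin d) :
    sqL2 Ω (w t) ≤ 4 * R ^ 2 * sqGrad Ω (w t) := by
  have hX : Admissible Ω (fun t x => x i * w t x) := by
    refine ⟨?_, ?_⟩
    · refine ContDiff.mul ?_ h.1
      exact (contDiff_piLp_apply (p := 2) (i := i)).comp contDiff_snd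
    · obtain ⟨K, hK, hKΩ, hs⟩ := h.2
      exact ⟨K, hK, hKΩ, fun t x hx => hs t (right_ne_zero_of_mul hx)⟩
  have hXd : ∀ x, _root_.pd i (fun t x => x i * w t x) t x
      = w t x + x i * _root_.pd i w t x := by
    intro x
    have h1 : HasFDerivAt (fun y : Spc d => y i) (EuclideanSpace.proj i : Spc d →L[ℝ] ℝ) x :=
      (EuclideanSpace.proj i : Spc d →L[ℝ] ℝ).hasFDerivAt
    have h2 : HasFDerivAt (w t) (fderiv ℝ (w t) x) x :=
      ((h.slice t).differentiable (by simp) x).hasFDerivAt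
    have h3 := (h1.mul h2).fderiv
    simp only [_root_.pd]
    refine Eq.trans (congrArg (fun L => L (EuclideanSpace.single i 1)) h3) ?_
    simp
    ring
  have e := hX.ibp h i t
  simp only [hXd] at e
  have i1 := h.sq.integrableOn t
  have i2 := (hX.mul (h.pd i)).integrableOn t
  have i3 := (h.pd i).sq.integrableOn t
  have e2 : ∫ x in Ω, (w t x + x i * _root_.pd i w t x) * w t x
      = sqL2 Ω (w t) + ∫ x in Ω, x i * w t x * _root_.pd i w t x := by
    rw [sqL2, ← integral_add i1 i2]
    congr 1; funext x; ring
  rw [e2] at e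
  have e3 : - (2 * ∫ x in Ω, x i * w t x * _root_.pd i w t x)
      ≤ (1/2) * sqL2 Ω (w t) + 2 * R^2 * sqL2 Ω (_root_.pd i w t) := by
    rw [sqL2, sqL2, ← integral_const_mul, ← integral_const_mul, ← integral_const_mul,
      ← integral_neg, ← integral_add (i1.const_mul _) (i3.const_mul _)]
    refine setIntegral_mono_on (i2.const_mul 2).neg ((i1.const_mul _).add (i3.const_mul _))
      hop.measurableSet fun x hx => ?_
    have hxi : (x i)^2 ≤ R^2 := by
      have a1 : ‖x i‖ ≤ ‖x‖ := PiLp.norm_apply_le x i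
      have a2 := hR x hx
      rw [← sq_abs]
      exact pow_le_pow_left₀ (abs_nonneg _) (a1.trans a2) 2
    nlinarith [sq_nonneg (w t x + 2 * x i * _root_.pd i w t x),
      mul_le_mul_of_nonneg_right hxi (sq_nonneg (_root_.pd i w t x))]
  have e4 : sqL2 Ω (_root_.pd i w t) ≤ sqGrad Ω (w t) := by
    rw [h.sqGrad_eq]
    exact Finset.single_le_sum (f := fun i => sqL2 Ω (_root_.pd i w t))
      (fun j _ => integral_nonneg fun x => sq_nonneg _) (Finset.mem_univ i)
  nlinarith [mul_le_mul_of_nonneg_left e4 (sq_nonneg R)]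

end Admissible

theorem sqL2_nonneg (Ω : Set (Spc d)) (g : Spc d → ℝ) : 0 ≤ sqL2 Ω g :=
  integral_nonneg fun _ => sq_nonneg _

theorem sqGrad_nonneg (Ω : Set (Spc d)) (g : Spc d → ℝ) : 0 ≤ sqGrad Ω g :=
  integral_nonneg fun _ => sq_nonneg _

theorem sqHess_nonneg (Ω : Set (Spc d)) (g : Spc d → ℝ) : 0 ≤ sqHess Ω g :=
  integral_nonneg fun _ => sq_nonneg _

namespace Admissible

variable {Ω : Set (Spc d)} {u w : ℝ → Spc d → ℝ}

theorem young (hu : Admissible Ω u) (h : Admissible Ω w) (t : ℝ) {l : ℝ} (hl : 0 < l) :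
    2 * ∫ x in Ω, u t x * w t x ≤ l * sqL2 Ω (u t) + l⁻¹ * sqL2 Ω (w t) := by
  have i1 := hu.sq.integrableOn t
  have i2 := h.sq.integrableOn t
  have i3 := (hu.mul h).integrableOn t
  rw [sqL2, sqL2, ← integral_const_mul, ← integral_const_mul, ← integral_const_mul,
    ← integral_add (i1.const_mul _) (i2.const_mul _)]
  refine integral_mono (i3.const_mul 2) ((i1.const_mul _).add (i2.const_mul _)) fun x => ?_
  have e : l * u t x ^ 2 + l⁻¹ * w t x ^ 2 - 2 * (u t x * w t x)
      = l⁻¹ * (l * u t x - w t x) ^ 2 := by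
    field_simp
    ring
  have : 0 ≤ l⁻¹ * (l * u t x - w t x) ^ 2 := by positivity
  show 2 * (u t x * w t x) ≤ l * u t x ^ 2 + l⁻¹ * w t x ^ 2
  linarith

theorem young_neg (hu : Admissible Ω u) (h : Admissible Ω w) (t : ℝ) {l : ℝ} (hl : 0 < l) :
    -(2 * ∫ x in Ω, u t x * w t x) ≤ l * sqL2 Ω (u t) + l⁻¹ * sqL2 Ω (w t) := by
  have := (hu.smul (-1)).young h t hl
  simpa [sqL2, integral_neg] using this

theorem sq_three {p q r s : ℝ → Spc d → ℝ} (hp : Admissible Ω p) (hq : Admissible Ω q)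
    (hr : Admissible Ω r) (hs : Admissible Ω s) (t α β γ : ℝ)
    (e : ∀ x, p t x = α * q t x + β * r t x + γ * s t x) :
    sqL2 Ω (p t) ≤ 3 * (α ^ 2 * sqL2 Ω (q t) + β ^ 2 * sqL2 Ω (r t) + γ ^ 2 * sqL2 Ω (s t)) := by
  have i0 := hp.sq.integrableOn t
  have i1 := (hq.sq.integrableOn t).const_mul (α ^ 2)
  have i2 := (hr.sq.integrableOn t).const_mul (β ^ 2)
  have i3 := (hs.sq.integrableOn t).const_mul (γ ^ 2)
  have i12 : Integrable (fun x => α ^ 2 * q t x ^ 2 + β ^ 2 * r t x ^ 2) (volume.restrict Ω) :=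
    i1.add i2
  have i123 := (i12.add i3).const_mul 3
  have : 3 * (α ^ 2 * sqL2 Ω (q t) + β ^ 2 * sqL2 Ω (r t) + γ ^ 2 * sqL2 Ω (s t))
      = ∫ x in Ω, 3 * (α ^ 2 * q t x ^ 2 + β ^ 2 * r t x ^ 2 + γ ^ 2 * s t x ^ 2) := by
    rw [integral_const_mul, integral_add i12 i3, integral_add i1 i2]
    simp only [integral_const_mul, sqL2]
  rw [this]
  refine integral_mono i0 i123 fun x => ?_
  show p t x ^ 2 ≤ 3 * (α ^ 2 * q t x ^ 2 + β ^ 2 * r t x ^ 2 + γ ^ 2 * s t x ^ 2)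
  rw [e x]
  nlinarith [sq_nonneg (α * q t x - β * r t x), sq_nonneg (α * q t x - γ * s t x),
    sq_nonneg (β * r t x - γ * s t x)]

theorem int_three {p q r s : ℝ → Spc d → ℝ} (z : ℝ → Spc d → ℝ) (hz : Admissible Ω z)
    (hq : Admissible Ω q)
    (hr : Admissible Ω r) (hs : Admissible Ω s) (t α β γ : ℝ)
    (e : ∀ x, p t x = α * q t x + β * r t x + γ * s t x) :
    ∫ x in Ω, p t x * z t x = α * (∫ x in Ω, q t x * z t x) + β * (∫ x in Ω, r t x * z t x)
      + γ * ∫ x in Ω, s t x * z t x := by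
  have i1 := ((hq.mul hz).integrableOn t).const_mul α
  have i2 := ((hr.mul hz).integrableOn t).const_mul β
  have i3 := ((hs.mul hz).integrableOn t).const_mul γ
  have i12 : Integrable (fun x => α * (q t x * z t x) + β * (r t x * z t x))
    (volume.restrict Ω) := i1.add i2
  rw [← integral_const_mul, ← integral_const_mul, ← integral_const_mul, ← integral_add i1 i2,
    ← integral_add i12 i3]
  congr 1; funext x
  rw [e x]
  ring

theorem lap_le_hess (h : Admissible Ω w) (t : ℝ) :
    sqL2 Ω (_root_.lap (w t)) ≤ (d : ℝ) ^ 2 * sqHess Ω (w t) := by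
  rw [sqL2, sqHess, ← integral_const_mul]
  have hc : Continuous (iteratedFDeriv ℝ 2 (w t)) :=
    (h.slice t).continuous_iteratedFDeriv (by exact WithTop.coe_le_coe.2 (le_top : (2 : ℕ∞) ≤ ⊤))
  have hcs : HasCompactSupport (iteratedFDeriv ℝ 2 (w t)) :=
    (h.tsupp t).1.iteratedFDeriv 2
  have hi : Integrable (fun x => ‖iteratedFDeriv ℝ 2 (w t) x‖ ^ 2) := by
    refine (hc.norm.pow 2).integrable_of_hasCompactSupport ?_
    refine hcs.mono fun x hx => ?_
    intro h0
    apply hx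
    simp [h0]
  refine integral_mono (h.lap.sq.integrableOn t) (hi.restrict.const_mul _) fun x => ?_
  show _root_.lap (w t) x ^ 2 ≤ (d : ℝ) ^ 2 * ‖iteratedFDeriv ℝ 2 (w t) x‖ ^ 2
  have hd1 : ContDiff ℝ (⊤ : ℕ∞) (fderiv ℝ (w t)) := (h.slice t).fderiv_right (by simp)
  have key : ∀ i : Fin d, |_root_.pd i (_root_.pd i w) t x| ≤ ‖iteratedFDeriv ℝ 2 (w t) x‖ := by
    intro i
    have e : _root_.pd i (_root_.pd i w) t x = iteratedFDeriv ℝ 2 (w t) x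
        ![EuclideanSpace.single i 1, EuclideanSpace.single i 1] := by
      rw [iteratedFDeriv_two_apply]
      have h2 : DifferentiableAt ℝ (fderiv ℝ (w t)) x := hd1.differentiable (by simp) x
      show fderiv ℝ (fun q => fderiv ℝ (w t) q (EuclideanSpace.single i 1)) x
        (EuclideanSpace.single i 1) = _
      rw [fderiv_clm_apply h2 (differentiableAt_const _)]
      simp
    rw [e, ← Real.norm_eq_abs]
    refine ((iteratedFDeriv ℝ 2 (w t) x).le_opNorm _).trans ?_
    simp [Fin.prod_univ_two]
  have h3 : |_root_.lap (w t) x| ≤ d * ‖iteratedFDeriv ℝ 2 (w t) x‖ := by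
    have : _root_.lap (w t) x = ∑ i, _root_.pd i (_root_.pd i w) t x := rfl
    rw [this]
    refine (Finset.abs_sum_le_sum_abs _ _).trans ?_
    refine (Finset.sum_le_sum fun i _ => key i).trans ?_
    simp
  rw [← sq_abs, ← mul_pow]
  exact pow_le_pow_left₀ (abs_nonneg _) h3 2

theorem pd_smul (h : Admissible Ω w) (r : ℝ) (i : Fin d) (t : ℝ) (x : Spc d) :
    _root_.pd i (fun t x => r * w t x) t x = r * _root_.pd i w t x := by
  have h2 : DifferentiableAt ℝ (w t) x := (h.slice t).differentiable (by simp) x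
  simp only [_root_.pd]
  rw [fderiv_const_mul h2]
  rfl

theorem sqGrad_smul (h : Admissible Ω w) (r t : ℝ) :
    sqGrad Ω (fun x => r * w t x) = r ^ 2 * sqGrad Ω (w t) := by
  have := (h.smul r).sqGrad_eq t
  refine this.trans ?_
  rw [h.sqGrad_eq, Finset.mul_sum]
  refine Finset.sum_congr rfl fun i _ => ?_
  simp only [sqL2]
  rw [← integral_const_mul]
  congr 1; funext x
  rw [h.pd_smul, mul_pow]

/-- Test functions for the dual norm. -/
def Test (Ω : Set (Spc d)) (φ : Spc d → ℝ) : Prop :=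
  ContDiff ℝ (⊤ : ℕ∞) φ ∧ HasCompactSupport φ ∧ tsupport φ ⊆ Ω ∧
      (∫ x in Ω, ‖gradient φ x‖ ^ 2) ≤ 1

theorem negH1_eq (Ω : Set (Spc d)) (g : Spc d → ℝ) :
    negH1 Ω g = ⨆ φ : {φ // Test Ω φ}, ∫ x in Ω, g x * φ.1 x := by
  rw [negH1, iSup]
  congr 1
  ext r
  constructor
  · rintro ⟨φ, h1, h2, h3, h4, rfl⟩
    exact ⟨⟨φ, h1, h2, h3, h4⟩, rfl⟩
  · rintro ⟨⟨φ, h1, h2, h3, h4⟩, rfl⟩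
    exact ⟨φ, h1, h2, h3, h4, rfl⟩

theorem test_bound (hop : IsOpen Ω) {R : ℝ} (hR : ∀ x ∈ Ω, ‖x‖ ≤ R) (i : Fin d)
    (h : Admissible Ω w) (t : ℝ) (φ : {φ // Test Ω φ}) :
    ∫ x in Ω, w t x * φ.1 x ≤ (1/2) * sqL2 Ω (w t) + 2 * R ^ 2 := by
  obtain ⟨φ, h1, h2, h3, h4⟩ := φ
  have hφ : Admissible Ω (fun _ => φ) := of_test h1 h2 h3
  have e1 := h.young hφ t one_pos
  have e2 := hφ.poincare hop t hR i
  have e3 : sqGrad Ω φ ≤ 1 := h4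
  have e4 := mul_le_mul_of_nonneg_left e3 (by positivity : 0 ≤ 4 * R ^ 2)
  simp only [inv_one, one_mul] at e1
  simp only at e1 e2 ⊢
  linarith

theorem test_bdd (hop : IsOpen Ω) {R : ℝ} (hR : ∀ x ∈ Ω, ‖x‖ ≤ R) (i : Fin d)
    (h : Admissible Ω w) (t : ℝ) :
    BddAbove (Set.range fun φ : {φ // Test Ω φ} => ∫ x in Ω, w t x * φ.1 x) := by
  refine ⟨(1/2) * sqL2 Ω (w t) + 2 * R ^ 2, ?_⟩
  rintro _ ⟨φ, rfl⟩
  exact test_bound hop hR i h t φ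

theorem test_zero : Test Ω (fun _ : Spc d => (0:ℝ)) := by
  have h0 := (zero : Admissible Ω (fun _ _ => (0:ℝ)))
  refine ⟨contDiff_const, (h0.tsupp 0).1, (h0.tsupp 0).2, ?_⟩
  simp [gradient]

theorem negH1_integrable (hop : IsOpen Ω) {R : ℝ} (hR : ∀ x ∈ Ω, ‖x‖ ≤ R) (i : Fin d)
    (h : Admissible Ω w) (T : ℝ) :
    IntegrableOn (fun t => t * negH1 Ω (w t) ^ 2) (Set.Icc 0 T) := by
  have hm : Measurable fun t => negH1 Ω (w t) := by
    simp only [negH1_eq]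
    apply LowerSemicontinuous.measurable
    refine lowerSemicontinuous_ciSup (fun t => test_bdd hop hR i h t) fun φ => ?_
    obtain ⟨φ, h1, h2, h3, h4⟩ := φ
    have hφ : Admissible Ω (fun _ => φ) := of_test h1 h2 h3
    exact (h.mul hφ).cont_int.lowerSemicontinuous
  have hnn : ∀ t, 0 ≤ negH1 Ω (w t) := by
    intro t
    rw [negH1_eq]
    refine le_ciSup_of_le (test_bdd hop hR i h t) ⟨_, test_zero⟩ ?_
    simp
  have hle : ∀ t, negH1 Ω (w t) ≤ (1/2) * sqL2 Ω (w t) + 2 * R ^ 2 := by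
    intro t
    rw [negH1_eq]
    have : Nonempty {φ // Test Ω φ} := ⟨⟨_, test_zero⟩⟩
    exact ciSup_le fun φ => test_bound hop hR i h t φ
  have hc : Continuous fun t => |t| * ((1/2) * sqL2 Ω (w t) + 2 * R ^ 2) ^ 2 := by
    have : Continuous fun t => sqL2 Ω (w t) := h.sq.cont_int
    fun_prop
  refine Integrable.mono' (hc.continuousOn.integrableOn_compact isCompact_Icc)
    (measurable_id.mul (hm.pow_const 2)).aestronglyMeasurable
    (Filter.Eventually.of_forall fun t => ?_)
  rw [Real.norm_eq_abs, abs_mul, abs_of_nonneg (sq_nonneg (negH1 Ω (w t)))]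
  exact mul_le_mul_of_nonneg_left (pow_le_pow_left₀ (hnn t) (hle t) 2) (abs_nonneg t)

theorem dual (hop : IsOpen Ω) {R : ℝ} (hR : ∀ x ∈ Ω, ‖x‖ ≤ R) (i : Fin d)
    (hu : Admissible Ω u) (h : Admissible Ω w) (t : ℝ) {b : ℝ} (hb : 0 < b) :
    ∫ x in Ω, u t x * w t x ≤ b * sqGrad Ω (w t) + negH1 Ω (u t) ^ 2 / (4 * b) := by
  apply le_of_forall_pos_le_add
  intro e he
  set D := sqGrad Ω (w t) with hD
  have hD0 : 0 ≤ D := sqGrad_nonneg _ _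
  set s := Real.sqrt (D + e / b) with hs
  have heb : 0 < e / b := by positivity
  have hspos : 0 < s := Real.sqrt_pos.2 (by positivity)
  have hs2 : s ^ 2 = D + e / b := Real.sq_sqrt (by positivity)
  have hw := h.smul s⁻¹
  have ht : Test Ω (fun x => s⁻¹ * w t x) := by
    refine ⟨hw.slice t, (hw.tsupp t).1, (hw.tsupp t).2, ?_⟩
    refine (h.sqGrad_smul s⁻¹ t).le.trans ?_
    rw [inv_pow, hs2, inv_mul_le_iff₀ (by positivity)]
    linarith
  have h1 : ∫ x in Ω, u t x * (s⁻¹ * w t x) ≤ negH1 Ω (u t) := by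
    rw [negH1_eq]
    exact le_ciSup (test_bdd hop hR i hu t) ⟨_, ht⟩
  have h2 : ∫ x in Ω, u t x * (s⁻¹ * w t x) = s⁻¹ * ∫ x in Ω, u t x * w t x := by
    rw [← integral_const_mul]
    congr 1; funext x; ring
  rw [h2, inv_mul_le_iff₀ hspos] at h1
  have h3 : s * negH1 Ω (u t) ≤ b * s ^ 2 + negH1 Ω (u t) ^ 2 / (4 * b) := by
    have e : b * s ^ 2 + negH1 Ω (u t) ^ 2 / (4 * b) - s * negH1 Ω (u t)
        = (2 * b * s - negH1 Ω (u t)) ^ 2 / (4 * b) := by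
      field_simp; ring
    have : 0 ≤ (2 * b * s - negH1 Ω (u t)) ^ 2 / (4 * b) := by positivity
    linarith
  rw [hs2] at h3
  have : b * (D + e / b) = b * D + e := by field_simp
  linarith

end Admissible

theorem sub_le_int {Φ Φ' h : ℝ → ℝ} {T : ℝ} (hd : ∀ t, HasDerivAt Φ (Φ' t) t)
    (hi : IntegrableOn h (Set.Icc 0 T)) (hnn : ∀ t ∈ Set.Icc 0 T, 0 ≤ h t)
    (hle : ∀ t ∈ Set.Ioo 0 T, Φ' t ≤ h t) {t : ℝ} (ht : t ∈ Set.Icc 0 T) :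
    Φ t - Φ 0 ≤ ∫ s in (0:ℝ)..T, h s := by
  have h1 : Φ t - Φ 0 ≤ ∫ s in (0:ℝ)..t, h s := by
    refine intervalIntegral.sub_le_integral_of_hasDeriv_right_of_le ht.1
      (fun s _ => (hd s).continuousAt.continuousWithinAt) (fun s _ => (hd s).hasDerivWithinAt)
      (hi.mono_set (Set.Icc_subset_Icc_right ht.2))
      (fun s hs => hle s ⟨hs.1, hs.2.trans_le ht.2⟩)
  refine h1.trans ?_
  refine intervalIntegral.integral_mono_interval le_rfl ht.1 ht.2 ?_ ?_
  · refine (ae_restrict_iff' measurableSet_Ioc).2 (Filter.Eventually.of_forall fun s hs => ?_)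
    exact hnn s ⟨hs.1.le, hs.2⟩
  · rw [intervalIntegrable_iff_integrableOn_Icc_of_le (ht.1.trans ht.2)]
    exact hi

theorem core (b c T κ : ℝ) (hb : 0 < b) (hc : 0 < c) (hT : 0 < T)
    (hκ : κ = (3 * (1 + T * c ^ 2) * b ^ 2 + T * c ^ 2) / b)
    {G L M P F N E' P' : ℝ → ℝ}
    (hG : ∀ t, 0 ≤ G t) (hL : ∀ t, 0 ≤ L t) (hM : ∀ t, 0 ≤ M t) (hP : ∀ t, 0 ≤ P t)
    (hF : ∀ t, 0 ≤ F t) (hN : ∀ t ∈ Set.Icc 0 T, 0 ≤ N t)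
    (dE : ∀ t, HasDerivAt (fun t => G t + c ^ 2 * L t) (E' t) t)
    (dP : ∀ t, HasDerivAt P (P' t) t)
    (hE' : ∀ t ∈ Set.Ioo 0 T, E' t ≤ - b * M t + b⁻¹ * F t)
    (hP' : ∀ t ∈ Set.Ioo 0 T, t * P' t ≤ t * (c ^ 2 * (P t + M t)) + N t / (2 * b))
    (hPM : ∀ t ∈ Set.Icc 0 T, P t ≤ 3 * (b ^ 2 * M t + c ^ 4 * L t + F t))
    (hMP : ∀ t ∈ Set.Icc 0 T, b ^ 2 * M t ≤ 3 * (P t + c ^ 4 * L t + F t))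
    (iF : IntegrableOn F (Set.Icc 0 T)) (iN : IntegrableOn N (Set.Icc 0 T))
    {X δ : ℝ} (x1 : G 0 ≤ X) (hδ : 0 ≤ δ) (x2 : L 0 ≤ δ * X)
    (x3 : ∫ t in (0:ℝ)..T, F t ≤ X)
    (x4 : ∫ t in (0:ℝ)..T, N t ≤ X) (x5 : ∀ t ∈ Set.Icc 0 T, t * F t ≤ X)
    {t : ℝ} (ht : t ∈ Set.Icc 0 T) :
    t * M t ≤ 3 / b ^ 2 * (κ * (1 + c ^ 2 * δ) + (3 * (1 + T * c ^ 2) + κ / b)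
      + 3 * (1 + T * c ^ 2) * c ^ 2 * (1 + c ^ 2 * δ + b⁻¹) * T + 1 / (2 * b)
      + T * c ^ 2 * (1 + c ^ 2 * δ + b⁻¹) + 1) * X := by
  have hκ0 : 0 < κ := by rw [hκ]; positivity
  have hκb : κ * b = 3 * (1 + T * c ^ 2) * b ^ 2 + T * c ^ 2 := by rw [hκ]; field_simp
  have hX : 0 ≤ X := (hG 0).trans x1
  set A := (1 + c ^ 2 * δ + b⁻¹) * X with hA
  have hA0 : 0 ≤ A := by positivity
  have hE0 : G 0 + c ^ 2 * L 0 ≤ (1 + c ^ 2 * δ) * X := by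
    nlinarith [mul_le_mul_of_nonneg_left x2 (sq_nonneg c)]
  -- step 1
  have s1 : ∀ t ∈ Set.Icc 0 T, c ^ 2 * L t ≤ A := by
    intro t ht
    have h := sub_le_int (h := fun t => b⁻¹ * F t) dE (iF.const_mul _)
      (fun s _ => mul_nonneg (by positivity) (hF s))
      (fun s hs => (hE' s hs).trans (by nlinarith [hM s])) ht
    simp only [intervalIntegral.integral_const_mul] at h
    have h2 := mul_le_mul_of_nonneg_left x3 (by positivity : 0 ≤ b⁻¹)
    have := hG t
    rw [hA]
    nlinarith
  -- step 2
  have dΦ : ∀ t, HasDerivAt (fun t => t * P t + κ * (G t + c ^ 2 * L t))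
      ((1 * P t + t * P' t) + κ * E' t) t := fun t =>
    ((hasDerivAt_id t).mul (dP t)).add ((dE t).const_mul κ)
  have iH : ∀ K1 K2 K3 : ℝ, IntegrableOn (fun t => K1 * F t + K2 + K3 * N t) (Set.Icc 0 T) :=
    fun K1 K2 K3 => ((iF.const_mul K1).add (integrableOn_const (by simp))).add (iN.const_mul K3)
  have h := sub_le_int (h := fun t => (3 * (1 + T * c ^ 2) + κ / b) * F t
      + 3 * (1 + T * c ^ 2) * c ^ 2 * A + 1 / (2 * b) * N t) dΦ (iH _ _ _) (by
        intro s hs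
        have := hF s
        have := hN s hs
        positivity) (by
        intro s hs
        have hs' : s ∈ Set.Icc 0 T := ⟨hs.1.le, hs.2.le⟩
        have a1 := hE' s hs
        have a2 := hP' s hs
        have a3 := hPM s hs'
        have a4 := s1 s hs'
        have a5 : s * (c ^ 2 * (P s + M s)) ≤ T * (c ^ 2 * (P s + M s)) :=
          mul_le_mul_of_nonneg_right hs.2.le
            (mul_nonneg (sq_nonneg c) (add_nonneg (hP s) (hM s)))
        have a6 := mul_le_mul_of_nonneg_left a3 (by positivity : 0 ≤ 1 + T * c ^ 2)
        have a7 := mul_le_mul_of_nonneg_left a1 hκ0.le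
        have a8 := mul_le_mul_of_nonneg_left a4 (by positivity : 0 ≤ 3 * (1 + T * c ^ 2) * c ^ 2)
        have a9 : κ * (- b * M s + b⁻¹ * F s) = - (κ * b) * M s + κ / b * F s := by
          rw [div_eq_mul_inv]; ring
        rw [a9, hκb] at a7
        have a10 : N s / (2 * b) = 1 / (2 * b) * N s := by ring
        rw [a10] at a2
        show 1 * P s + s * P' s + κ * E' s ≤ (3 * (1 + T * c ^ 2) + κ / b) * F s
          + 3 * (1 + T * c ^ 2) * c ^ 2 * A + 1 / (2 * b) * N s
        linarith) ht
  have i1 : IntervalIntegrable F volume 0 T := by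
    rw [intervalIntegrable_iff_integrableOn_Icc_of_le hT.le]; exact iF
  have i2 : IntervalIntegrable N volume 0 T := by
    rw [intervalIntegrable_iff_integrableOn_Icc_of_le hT.le]; exact iN
  rw [intervalIntegral.integral_add ((i1.const_mul _).add (by simp)) (i2.const_mul _),
    intervalIntegral.integral_add (i1.const_mul _) (by simp),
    intervalIntegral.integral_const] at h
  simp only [intervalIntegral.integral_const_mul, zero_mul, zero_add, sub_zero, smul_eq_mul] at h
  have b1 := mul_le_mul_of_nonneg_left x3 (by positivity : 0 ≤ 3 * (1 + T * c ^ 2) + κ / b)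
  have b2 := mul_le_mul_of_nonneg_left x4 (by positivity : 0 ≤ 1 / (2 * b))
  have b3 := mul_le_mul_of_nonneg_left hE0 hκ0.le
  have b4 : 0 ≤ κ * (G t + c ^ 2 * L t) :=
    mul_nonneg hκ0.le (add_nonneg (hG t) (mul_nonneg (sq_nonneg c) (hL t)))
  have b5 : t * P t ≤ κ * ((1 + c ^ 2 * δ) * X) + (3 * (1 + T * c ^ 2) + κ / b) * X
      + T * (3 * (1 + T * c ^ 2) * c ^ 2 * A) + 1 / (2 * b) * X := by linarith
  have b6 : t * (c ^ 4 * L t) ≤ T * c ^ 2 * A := by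
    have := mul_le_mul_of_nonneg_left (s1 t ht) (sq_nonneg c)
    have h0 : 0 ≤ c ^ 4 * L t := mul_nonneg (by positivity) (hL t)
    calc t * (c ^ 4 * L t) ≤ T * (c ^ 4 * L t) := mul_le_mul_of_nonneg_right ht.2 h0
      _ ≤ T * (c ^ 2 * A) := mul_le_mul_of_nonneg_left (by linarith) hT.le
      _ = _ := by ring
  have b7 := mul_le_mul_of_nonneg_left (hMP t ht) ht.1
  have b8 := x5 t ht
  have b9 : b ^ 2 * (t * M t) ≤ 3 * (κ * ((1 + c ^ 2 * δ) * X)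
      + (3 * (1 + T * c ^ 2) + κ / b) * X
      + T * (3 * (1 + T * c ^ 2) * c ^ 2 * A) + 1 / (2 * b) * X + T * c ^ 2 * A + X) := by
    linarith
  have b10 : t * M t ≤ (3 * (κ * ((1 + c ^ 2 * δ) * X)
      + (3 * (1 + T * c ^ 2) + κ / b) * X
      + T * (3 * (1 + T * c ^ 2) * c ^ 2 * A) + 1 / (2 * b) * X + T * c ^ 2 * A + X)) / b ^ 2 := by
    rw [le_div_iff₀ (by positivity)]
    linarith
  refine b10.trans (le_of_eq ?_)
  rw [hA]
  ring

/-- time-weighted bound on Δv for the nonlocal heat equation. -/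
theorem heat_weighted_laplacian_estimate (d : ℕ) (hd : d = 1 ∨ d = 2 ∨ d = 3)
    (Ω : Set (Spc d)) (hne : Ω.Nonempty) (hop : IsOpen Ω) (hbd : Bornology.IsBounded Ω)
    (b c : ℝ) (hb : 0 < b) (hc : 0 < c) (T : ℝ) (hT : 0 < T) :
    ∃ C > (0:ℝ),
      ∀ ψ f : ℝ → Spc d → ℝ, Admissible Ω ψ → Admissible Ω f →
        (∀ t ∈ Set.Icc (0:ℝ) T, IsHeat Ω b c ψ f t) →
        supIcc T (fun t => Real.sqrt t * Real.sqrt (sqL2 Ω (lap (tderiv ψ t))))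
        ≤ C * (Real.sqrt (sqH2 Ω (ψ 0)) + Real.sqrt (sqH1 Ω (tderiv ψ 0))
            + Real.sqrt (∫ t in (0:ℝ)..T, sqL2 Ω (f t))
            + supIcc T (fun t => Real.sqrt t * Real.sqrt (sqL2 Ω (f t)))
            + Real.sqrt (∫ t in (0:ℝ)..T, t * (negH1 Ω (tderiv f t)) ^ 2)) := by
  have hd0 : 0 < d := by omega
  let i : Fin d := ⟨0, hd0⟩
  obtain ⟨R, hR⟩ := hbd.exists_norm_le
  set κ := (3 * (1 + T * c ^ 2) * b ^ 2 + T * c ^ 2) / b with hκ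
  have hκ0 : 0 < κ := by positivity
  set δ : ℝ := (d : ℝ) ^ 2 with hδ
  set Q := 3 / b ^ 2 * (κ * (1 + c ^ 2 * δ) + (3 * (1 + T * c ^ 2) + κ / b)
      + 3 * (1 + T * c ^ 2) * c ^ 2 * (1 + c ^ 2 * δ + b⁻¹) * T + 1 / (2 * b)
      + T * c ^ 2 * (1 + c ^ 2 * δ + b⁻¹) + 1) with hQ
  have hQ0 : 0 < Q := by positivity
  refine ⟨Real.sqrt Q, Real.sqrt_pos.2 hQ0, fun ψ f hψ hf heat => ?_⟩
  have hv := hψ.td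
  have hvt := hv.td
  have hlψ := hψ.lap
  have hlv := hv.lap
  have hlvt := hvt.lap
  have hft := hf.td
  -- the equation on the whole space
  have eq1 : ∀ t ∈ Set.Icc 0 T, ∀ x, tderiv (tderiv ψ) t x
      = b * lap (tderiv ψ t) x + c ^ 2 * lap (ψ t) x + 1 * f t x := by
    intro t ht x
    by_cases hx : x ∈ Ω
    · have := heat t ht x hx
      linarith
    · rw [hvt.eq_zero hx, hf.eq_zero hx]
      have a1 : lap (tderiv ψ t) x = 0 := hlv.eq_zero hx
      have a2 : lap (ψ t) x = 0 := hlψ.eq_zero hx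
      simp [a1, a2]
  have eq2 : ∀ t ∈ Set.Ioo 0 T, ∀ x, tderiv (tderiv (tderiv ψ)) t x
      = b * lap (tderiv (tderiv ψ) t) x + c ^ 2 * lap (tderiv ψ t) x + 1 * tderiv f t x := by
    intro t ht x
    have h1 := hvt.hasDerivAt t x
    have h2 := (((hlv.hasDerivAt t x).const_mul b).add ((hlψ.hasDerivAt t x).const_mul (c ^ 2))).add
      ((hf.hasDerivAt t x).const_mul 1)
    rw [hv.td_lap, hψ.td_lap] at h2
    have h3 := h2.congr_of_eventuallyEq (f₁ := fun s => tderiv (tderiv ψ) s x) (by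
      filter_upwards [Ioo_mem_nhds ht.1 ht.2] with s hs
      exact eq1 s ⟨hs.1.le, hs.2.le⟩ x)
    exact h1.unique h3
  -- right-hand side quantities
  set S := Real.sqrt (sqH2 Ω (ψ 0)) + Real.sqrt (sqH1 Ω (tderiv ψ 0))
            + Real.sqrt (∫ t in (0:ℝ)..T, sqL2 Ω (f t))
            + supIcc T (fun t => Real.sqrt t * Real.sqrt (sqL2 Ω (f t)))
            + Real.sqrt (∫ t in (0:ℝ)..T, t * (negH1 Ω (tderiv f t)) ^ 2) with hS
  have cF : Continuous fun t => sqL2 Ω (f t) := hf.sq.cont_int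
  have hbdd : BddAbove (Set.range fun t : Set.Icc (0:ℝ) T =>
      Real.sqrt t * Real.sqrt (sqL2 Ω (f t))) := by
    have hc' : Continuous fun t : ℝ => Real.sqrt t * Real.sqrt (sqL2 Ω (f t)) :=
      Real.continuous_sqrt.mul (Real.continuous_sqrt.comp cF)
    obtain ⟨B, hB⟩ := (isCompact_Icc (a := (0:ℝ)) (b := T)).bddAbove_image hc'.continuousOn
    refine ⟨B, ?_⟩
    rintro _ ⟨t, rfl⟩
    exact hB ⟨t, t.2, rfl⟩
  have hsup : ∀ t ∈ Set.Icc 0 T, Real.sqrt t * Real.sqrt (sqL2 Ω (f t))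
      ≤ supIcc T (fun t => Real.sqrt t * Real.sqrt (sqL2 Ω (f t))) := fun t ht =>
    le_ciSup hbdd ⟨t, ht⟩
  have p1 := Real.sqrt_nonneg (sqH2 Ω (ψ 0))
  have p2 := Real.sqrt_nonneg (sqH1 Ω (tderiv ψ 0))
  have p3 := Real.sqrt_nonneg (∫ t in (0:ℝ)..T, sqL2 Ω (f t))
  have p4 : 0 ≤ supIcc T (fun t => Real.sqrt t * Real.sqrt (sqL2 Ω (f t))) :=
    (mul_nonneg (Real.sqrt_nonneg 0) (Real.sqrt_nonneg _)).trans (hsup 0 ⟨le_rfl, hT.le⟩)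
  have p5 := Real.sqrt_nonneg (∫ t in (0:ℝ)..T, t * (negH1 Ω (tderiv f t)) ^ 2)
  have hS0 : 0 ≤ S := by positivity
  have le_of_sqrt : ∀ y : ℝ, Real.sqrt y ≤ S → y ≤ S ^ 2 := fun y hy =>
    (Real.sqrt_le_left hS0).1 hy
  have x1 : sqGrad Ω (tderiv ψ 0) ≤ S ^ 2 := by
    have := le_of_sqrt (sqH1 Ω (tderiv ψ 0)) (by linarith)
    have h2 := sqL2_nonneg Ω (tderiv ψ 0)
    rw [sqH1] at this
    linarith
  have x2 : sqL2 Ω (lap (ψ 0)) ≤ δ * S ^ 2 := by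
    have := le_of_sqrt (sqH2 Ω (ψ 0)) (by linarith)
    have h2 := sqL2_nonneg Ω (ψ 0)
    have h3 := sqGrad_nonneg Ω (ψ 0)
    rw [sqH2] at this
    exact (hψ.lap_le_hess 0).trans (mul_le_mul_of_nonneg_left (by linarith) (sq_nonneg _))
  have x3 : ∫ t in (0:ℝ)..T, sqL2 Ω (f t) ≤ S ^ 2 := le_of_sqrt _ (by linarith)
  have x4 : ∫ t in (0:ℝ)..T, t * (negH1 Ω (tderiv f t)) ^ 2 ≤ S ^ 2 := le_of_sqrt _ (by linarith)
  have x5 : ∀ t ∈ Set.Icc 0 T, t * sqL2 Ω (f t) ≤ S ^ 2 := by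
    intro t ht
    apply le_of_sqrt
    rw [Real.sqrt_mul ht.1]
    have := hsup t ht
    linarith
  have main : ∀ t ∈ Set.Icc 0 T, t * sqL2 Ω (lap (tderiv ψ t)) ≤ Q * S ^ 2 := by
    intro t ht
    refine core b c T κ hb hc hT hκ (G := fun t => sqGrad Ω (tderiv ψ t))
      (L := fun t => sqL2 Ω (lap (ψ t))) (M := fun t => sqL2 Ω (lap (tderiv ψ t)))
      (P := fun t => sqL2 Ω (tderiv (tderiv ψ) t)) (F := fun t => sqL2 Ω (f t))
      (N := fun t => t * (negH1 Ω (tderiv f t)) ^ 2)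
      (fun t => sqGrad_nonneg _ _) (fun t => sqL2_nonneg _ _) (fun t => sqL2_nonneg _ _)
      (fun t => sqL2_nonneg _ _) (fun t => sqL2_nonneg _ _)
      (fun t ht => mul_nonneg ht.1 (sq_nonneg _))
      (fun t => (hv.hasDerivAt_grad t).add ((hlψ.hasDerivAt_sq t).const_mul (c ^ 2)))
      (fun t => hvt.hasDerivAt_sq t) ?_ ?_ ?_ ?_
      (cF.continuousOn.integrableOn_compact isCompact_Icc)
      (hft.negH1_integrable hop hR i T) x1 (sq_nonneg _) x2 x3 x4 x5 ht
    · intro t ht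
      have e := Admissible.int_three (fun t => lap (tderiv ψ t)) hlv hlv hlψ hf t b (c ^ 2) 1
        (eq1 t ⟨ht.1.le, ht.2.le⟩)
      have y := hlv.young_neg hf t hb
      simp only [hψ.td_lap]
      rw [e]
      have e2 : ∫ x in Ω, lap (tderiv ψ t) x * lap (tderiv ψ t) x
          = sqL2 Ω (lap (tderiv ψ t)) := by simp [sqL2, pow_two]
      have e3 : ∫ x in Ω, f t x * lap (tderiv ψ t) x = ∫ x in Ω, lap (tderiv ψ t) x * f t x := by
        simp only [mul_comm]
      rw [e2, e3]
      linarith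
    · intro t ht
      have e := Admissible.int_three (tderiv (tderiv ψ)) hvt hlvt hlv hft t b (c ^ 2) 1
        (eq2 t ht)
      have y := hlv.young hvt t one_pos
      have du := Admissible.dual hop hR i hft hvt t hb
      have e2 : ∫ x in Ω, lap (tderiv (tderiv ψ) t) x * tderiv (tderiv ψ) t x
          = - sqGrad Ω (tderiv (tderiv ψ) t) := by
        rw [← hvt.sqGrad_eq_lap]
        simp only [mul_comm]
      have e3 : ∫ x in Ω, tderiv (tderiv ψ) t x * tderiv (tderiv (tderiv ψ)) t x
          = ∫ x in Ω, tderiv (tderiv (tderiv ψ)) t x * tderiv (tderiv ψ) t x := by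
        simp only [mul_comm]
      rw [e2] at e
      rw [e3, e]
      have y2 := mul_le_mul_of_nonneg_left y (sq_nonneg c)
      have e4 : t * negH1 Ω (tderiv f t) ^ 2 / (2 * b)
          = t * (2 * (negH1 Ω (tderiv f t) ^ 2 / (4 * b))) := by field_simp; ring
      simp only [inv_one, one_mul] at y2
      rw [e4, ← mul_add]
      refine mul_le_mul_of_nonneg_left ?_ ht.1.le
      linarith
    · intro t ht
      have := Admissible.sq_three hvt hlv hlψ hf t b (c ^ 2) 1 (eq1 t ht)
      nlinarith
    · intro t ht
      have := Admissible.sq_three (hlv.smul b) hvt hlψ hf t 1 (-(c ^ 2)) (-1) (by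
        intro x
        have := eq1 t ht x
        linarith)
      have e : sqL2 Ω (fun x => b * lap (tderiv ψ t) x) = b ^ 2 * sqL2 Ω (lap (tderiv ψ t)) := by
        simp only [sqL2, mul_pow, integral_const_mul]
      simp only [e] at this ⊢
      nlinarith
  have : Nonempty (Set.Icc (0:ℝ) T) := ⟨⟨0, le_rfl, hT.le⟩⟩
  refine ciSup_le fun t => ?_
  have h1 := Real.sqrt_le_sqrt (main t t.2)
  rw [Real.sqrt_mul t.2.1, Real.sqrt_mul hQ0.le, Real.sqrt_sq hS0] at h1
  exact h1
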